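/- Assume Θ is compact and g(x,β) is twice differentiable with respect to β for all x. For the normal–truncated-normal pseudo conditional density and for the normal–exponential pseudo conditional density, for every α > 0 there exists a constant C such that for all θ ∈ Θ and all (x,y): f_θ^{α−1}(y|x) · ‖∂_θ f_θ(y|x)‖ ≤ C (1 + sup_{θ∈Θ} ‖∂_β g(x,β)‖). -/

import Mathlib

open MeasureTheory ProbabilityTheory Real Set Filter
open scoped ENNReal NNReal

/-- The standard normal density φ(t) = (2π)^{-1/2} e^{-t²/2}. -/
noncomputable def stdGaussPdf (t : ℝ) : ℝ := (Real.sqrt (2 * Real.pi))⁻¹ * Real.exp (-(t ^ 2) / 2)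

/-- The standard normal cumulative distribution function Φ. -/
noncomputable def stdGaussCdf (t : ℝ) : ℝ := ∫ s in Set.Iic t, stdGaussPdf s

/-- The normal–truncated-normal pseudo conditional density
f_θ(y|x) = (1/σ)[1−Φ(−μ/σ_u)]⁻¹ φ((y−g(x,β)+μ)/σ) Φ(μ/(σλ) − λ(y−g(x,β))/σ),
with σ² = σ_v² + σ_u², λ = σ_u/σ_v, and θ = (β, μ, σ_v, σ_u). -/
noncomputable def fNT {p q : ℕ} (g : (Fin p → ℝ) → (Fin q → ℝ) → ℝ)
    (θ : (Fin q → ℝ) × ℝ × ℝ × ℝ) (x : Fin p → ℝ) (y : ℝ) : ℝ :=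
  let β := θ.1; let μ := θ.2.1; let σv := θ.2.2.1; let σu := θ.2.2.2
  let σ := Real.sqrt (σv ^ 2 + σu ^ 2)
  let lam := σu / σv
  σ⁻¹ * (1 - stdGaussCdf (-(μ / σu)))⁻¹ * stdGaussPdf ((y - g x β + μ) / σ) *
    stdGaussCdf (μ / (σ * lam) - lam * (y - g x β) / σ)

/-- The normal–exponential pseudo conditional density
f_θ(y|x) = (1/σ_u) Φ(−(y−g(x,β))/σ_v − σ_v/σ_u) exp((y−g(x,β))/σ_u + σ_v²/(2σ_u²)),
with θ = (β, σ_v, σ_u). -/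
noncomputable def fNE {p q : ℕ} (g : (Fin p → ℝ) → (Fin q → ℝ) → ℝ)
    (θ : (Fin q → ℝ) × ℝ × ℝ) (x : Fin p → ℝ) (y : ℝ) : ℝ :=
  let β := θ.1; let σv := θ.2.1; let σu := θ.2.2
  σu⁻¹ * stdGaussCdf (-((y - g x β) / σv) - σv / σu) *
    Real.exp ((y - g x β) / σu + σv ^ 2 / (2 * σu ^ 2))

/-- The objective function H_α(x,y;θ) = ∫ f_θ^{1+α}(y'|x) dy' − (1+1/α) f_θ^α(y|x)
of the minimum density power divergence estimator. -/
noncomputable def dpdH {P XS : Type*} (a : ℝ) (f : P → XS → ℝ → ℝ)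
    (θ : P) (x : XS) (y : ℝ) : ℝ :=
  (∫ y' : ℝ, f θ x y' ^ (1 + a)) - (1 + 1 / a) * f θ x y ^ a

/-- The compact parameter box Θ = [b̲,b̄]^q × [u̲,ū] × [σ̲,σ̄]² of the
normal–truncated-normal specification. -/
def boxNT (q : ℕ) (bl bu ul uu sl su : ℝ) : Set ((Fin q → ℝ) × ℝ × ℝ × ℝ) :=
  (Set.Icc (fun _ => bl) (fun _ => bu)) ×ˢ ((Set.Icc ul uu) ×ˢ ((Set.Icc sl su) ×ˢ (Set.Icc sl su)))

/-- The compact parameter box Θ = [b̲,b̄]^q × [σ̲,σ̄]² of the normal–exponential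
specification. -/
def boxNE (q : ℕ) (bl bu sl su : ℝ) : Set ((Fin q → ℝ) × ℝ × ℝ) :=
  (Set.Icc (fun _ => bl) (fun _ => bu)) ×ˢ ((Set.Icc sl su) ×ˢ (Set.Icc sl su))


lemma stdGaussPdf_eq_gaussianPDFReal (t : ℝ) : stdGaussPdf t = gaussianPDFReal 0 1 t := by
  simp [stdGaussPdf, gaussianPDFReal]

lemma integrable_stdGaussPdf : Integrable stdGaussPdf :=
  (integrable_gaussianPDFReal 0 1).congr
    (ae_of_all _ fun t => (stdGaussPdf_eq_gaussianPDFReal t).symm)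

lemma integral_stdGaussPdf : ∫ t, stdGaussPdf t = 1 := by
  simp only [stdGaussPdf_eq_gaussianPDFReal]
  exact integral_gaussianPDFReal_eq_one 0 one_ne_zero

lemma stdGaussPdf_pos (t : ℝ) : 0 < stdGaussPdf t := by
  unfold stdGaussPdf; positivity

lemma continuous_stdGaussPdf : Continuous stdGaussPdf := by
  unfold stdGaussPdf; fun_prop

lemma hasDerivAt_stdGaussCdf (t : ℝ) : HasDerivAt stdGaussCdf (stdGaussPdf t) t := by
  have h : stdGaussCdf = fun t => stdGaussCdf 0 + ∫ s in (0 : ℝ)..t, stdGaussPdf s := by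
    ext u
    rw [← intervalIntegral.integral_Iic_sub_Iic integrable_stdGaussPdf.integrableOn
      integrable_stdGaussPdf.integrableOn]
    simp [stdGaussCdf]
  rw [h]
  exact (continuous_stdGaussPdf.integral_hasStrictDerivAt 0 t).hasDerivAt.const_add _

lemma contDiff_stdGaussCdf : ContDiff ℝ 1 stdGaussCdf := by
  rw [contDiff_one_iff_deriv]
  refine ⟨fun t => (hasDerivAt_stdGaussCdf t).differentiableAt, ?_⟩
  rw [show deriv stdGaussCdf = stdGaussPdf from funext fun t => (hasDerivAt_stdGaussCdf t).deriv]
  exact continuous_stdGaussPdf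

lemma strictMono_stdGaussCdf : StrictMono stdGaussCdf :=
  strictMono_of_hasDerivAt_pos hasDerivAt_stdGaussCdf stdGaussPdf_pos

lemma stdGaussCdf_le_one (t : ℝ) : stdGaussCdf t ≤ 1 := by
  rw [← integral_stdGaussPdf]
  exact setIntegral_le_integral integrable_stdGaussPdf (ae_of_all _ fun s => (stdGaussPdf_pos s).le)

lemma stdGaussCdf_lt_one (t : ℝ) : stdGaussCdf t < 1 :=
  (strictMono_stdGaussCdf (lt_add_one t)).trans_le (stdGaussCdf_le_one _)

lemma stdGaussCdf_pos (t : ℝ) : 0 < stdGaussCdf t :=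
  lt_of_le_of_lt (setIntegral_nonneg measurableSet_Iic fun s _ => (stdGaussPdf_pos s).le)
    (strictMono_stdGaussCdf (sub_one_lt t))

/-- The inverse Mills ratio of the standard normal law grows at most linearly. -/
lemma stdGaussPdf_le_mul_stdGaussCdf (z : ℝ) :
    stdGaussPdf z ≤ Real.exp (3 / 2) * (1 + |z|) * stdGaussCdf z := by
  have hz : 0 < 1 + |z| := by positivity
  set d := (1 + |z|)⁻¹ with hd
  have hd0 : 0 < d := by positivity
  have hd1 : d ≤ 1 := inv_le_one_of_one_le₀ (by linarith [abs_nonneg z])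
  have hdz : d * |z| ≤ 1 := by
    have : d * (1 + |z|) = 1 := inv_mul_cancel₀ hz.ne'
    linarith
  have key : ∀ s ∈ Set.Icc (z - d) z, Real.exp (-(3 / 2)) * stdGaussPdf z ≤ stdGaussPdf s := by
    intro s hs
    have h1 : |s| ≤ |z| + d := by
      have : |s - z| ≤ d := abs_le.2 ⟨by linarith [hs.1], by linarith [hs.2]⟩
      linarith [abs_sub_abs_le_abs_sub s z]
    have h2 : s ^ 2 ≤ z ^ 2 + 3 := by
      rw [← sq_abs s, ← sq_abs z]
      nlinarith [abs_nonneg s, abs_nonneg z]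
    unfold stdGaussPdf
    rw [mul_left_comm, ← Real.exp_add]
    gcongr
    linarith
  have h3 : d * (Real.exp (-(3 / 2)) * stdGaussPdf z) ≤ stdGaussCdf z := by
    have h4 := intervalIntegral.integral_mono_on (a := z - d) (b := z) (μ := volume) (by linarith)
      (f := fun _ => Real.exp (-(3 / 2)) * stdGaussPdf z) (g := stdGaussPdf)
      (by simp) (continuous_stdGaussPdf.intervalIntegrable _ _) key
    rw [← intervalIntegral.integral_Iic_sub_Iic integrable_stdGaussPdf.integrableOn
      integrable_stdGaussPdf.integrableOn] at h4
    have h5 := stdGaussCdf_pos (z - d)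
    simp only [intervalIntegral.integral_const, smul_eq_mul, sub_sub_cancel] at h4
    change _ ≤ stdGaussCdf z - stdGaussCdf (z - d) at h4
    linarith
  calc stdGaussPdf z
      = Real.exp (3 / 2) * (1 + |z|) * (d * (Real.exp (-(3 / 2)) * stdGaussPdf z)) := by
        rw [Real.exp_neg, hd]; field_simp
    _ ≤ _ := by gcongr

/-- Chernoff bound for the standard normal distribution function. -/
lemma stdGaussCdf_le_exp (z t : ℝ) (ht : 0 ≤ t) :
    stdGaussCdf z ≤ Real.exp (t * z + t ^ 2 / 2) := by
  have hi : Integrable (fun s => stdGaussPdf (s + t)) := integrable_stdGaussPdf.comp_add_right t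
  calc stdGaussCdf z
      ≤ ∫ s in Set.Iic z, Real.exp (t * z + t ^ 2 / 2) * stdGaussPdf (s + t) := by
        refine setIntegral_mono_on integrable_stdGaussPdf.integrableOn
          (hi.const_mul _).integrableOn measurableSet_Iic fun s hs => ?_
        unfold stdGaussPdf
        rw [mul_left_comm, ← Real.exp_add]
        gcongr
        have hs : s ≤ z := hs
        nlinarith [mul_nonneg ht (sub_nonneg.2 hs)]
    _ ≤ ∫ s, Real.exp (t * z + t ^ 2 / 2) * stdGaussPdf (s + t) :=
        setIntegral_le_integral (hi.const_mul _)
          (ae_of_all _ fun s => mul_nonneg (Real.exp_pos _).le (stdGaussPdf_pos _).le)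
    _ = Real.exp (t * z + t ^ 2 / 2) := by
        rw [integral_const_mul, integral_add_right_eq_self (fun s => stdGaussPdf s),
          integral_stdGaussPdf, mul_one]

lemma IsCompact.exists_bound_of_contDiffAt {P : Type*} [NormedAddCommGroup P] [NormedSpace ℝ P]
    {K : Set P} (hK : IsCompact K) {H : P → ℝ} (hH : ∀ p ∈ K, ContDiffAt ℝ 1 H p) :
    ∃ M : ℝ, ∀ p ∈ K, |H p| ≤ M ∧ ‖fderiv ℝ H p‖ ≤ M := by
  obtain ⟨M₁, h₁⟩ := hK.exists_bound_of_continuousOn (f := H)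
    fun p hp => (hH p hp).continuousAt.continuousWithinAt
  obtain ⟨M₂, h₂⟩ := hK.exists_bound_of_continuousOn (f := fderiv ℝ H)
    fun p hp => ((hH p hp).fderiv_right (m := 0) (by simp)).continuousAt.continuousWithinAt
  exact ⟨max M₁ M₂, fun p hp => ⟨(h₁ p hp).trans (le_max_left _ _),
    (h₂ p hp).trans (le_max_right _ _)⟩⟩

/-- A density of the form `exp (H₀ + H₁ r + H₂ r²) Φ(Z₀ + Z₁ r)` in the residual `r`, with
coefficients depending on the parameter `p`. -/
noncomputable def skewDensity {P : Type*} (H₀ H₁ H₂ Z₀ Z₁ : P → ℝ) (p : P) (r : ℝ) : ℝ :=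
  Real.exp (H₀ p + H₁ p * r + H₂ p * (r * r)) * stdGaussCdf (Z₀ p + Z₁ p * r)

lemma skewDensity_pos {P : Type*} {H₀ H₁ H₂ Z₀ Z₁ : P → ℝ} (p : P) (r : ℝ) :
    0 < skewDensity H₀ H₁ H₂ Z₀ Z₁ p r :=
  mul_pos (Real.exp_pos _) (stdGaussCdf_pos _)

lemma norm_smul_add_smul_le {V : Type*} [SeminormedAddCommGroup V] [NormedSpace ℝ V]
    {c r A B D : ℝ} {u v : V} (hc : |c| ≤ A) (hu : ‖u‖ ≤ B) (hv : ‖v‖ ≤ D) :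
    ‖c • u + r • v‖ ≤ A * B + |r| * D := by
  refine (norm_add_le _ _).trans ?_
  rw [norm_smul, norm_smul, Real.norm_eq_abs, Real.norm_eq_abs]
  have := (abs_nonneg c).trans hc
  gcongr

section SkewDensity

variable {E P : Type*} [NormedAddCommGroup E] [NormedSpace ℝ E] [NormedAddCommGroup P]
  [NormedSpace ℝ P] {H₀ H₁ H₂ Z₀ Z₁ : P → ℝ}

lemma norm_fderiv_skewDensity_le {M : ℝ} {θ : E × P} {y : ℝ} {G : E → ℝ}
    (hG : DifferentiableAt ℝ G θ.1)
    (hH₀ : DifferentiableAt ℝ H₀ θ.2) (hH₁ : DifferentiableAt ℝ H₁ θ.2)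
    (hH₂ : DifferentiableAt ℝ H₂ θ.2)
    (hZ₀ : DifferentiableAt ℝ Z₀ θ.2) (hZ₁ : DifferentiableAt ℝ Z₁ θ.2)
    (bH₀ : ‖fderiv ℝ H₀ θ.2‖ ≤ M)
    (bH₁ : |H₁ θ.2| ≤ M ∧ ‖fderiv ℝ H₁ θ.2‖ ≤ M) (bH₂ : |H₂ θ.2| ≤ M ∧ ‖fderiv ℝ H₂ θ.2‖ ≤ M)
    (bZ₀ : |Z₀ θ.2| ≤ M ∧ ‖fderiv ℝ Z₀ θ.2‖ ≤ M) (bZ₁ : |Z₁ θ.2| ≤ M ∧ ‖fderiv ℝ Z₁ θ.2‖ ≤ M) :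
    ‖fderiv ℝ (fun t : E × P => skewDensity H₀ H₁ H₂ Z₀ Z₁ t.2 (y - G t.1)) θ‖ ≤
      skewDensity H₀ H₁ H₂ Z₀ Z₁ θ.2 (y - G θ.1) *
        ((2 * M + Real.exp (3 / 2) * (1 + M) * M) * (1 + |y - G θ.1|) ^ 2 *
          (1 + ‖fderiv ℝ G θ.1‖)) := by
  set r := y - G θ.1 with hr
  set D := ‖fderiv ℝ G θ.1‖ with hD
  have hM : 0 ≤ M := (norm_nonneg _).trans bH₀
  have hD0 : 0 ≤ D := norm_nonneg _
  have hsnd : ∀ {H : P → ℝ}, DifferentiableAt ℝ H θ.2 →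
      HasFDerivAt (fun t : E × P => H t.2)
        ((fderiv ℝ H θ.2).comp (ContinuousLinearMap.snd ℝ E P)) θ :=
    fun h => h.hasFDerivAt.comp θ hasFDerivAt_snd
  have nsnd : ∀ {H : P → ℝ}, ‖fderiv ℝ H θ.2‖ ≤ M →
      ‖(fderiv ℝ H θ.2).comp (ContinuousLinearMap.snd ℝ E P)‖ ≤ M := fun {H} h =>
    ((ContinuousLinearMap.opNorm_comp_le _ _).trans (mul_le_of_le_one_right (norm_nonneg _)
      (ContinuousLinearMap.norm_snd_le ℝ E P))).trans h
  have hr' : HasFDerivAt (fun t : E × P => y - G t.1)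
      (-(fderiv ℝ G θ.1).comp (ContinuousLinearMap.fst ℝ E P)) θ :=
    (hG.hasFDerivAt.comp θ hasFDerivAt_fst).const_sub y
  have nr' : ‖-(fderiv ℝ G θ.1).comp (ContinuousLinearMap.fst ℝ E P)‖ ≤ D := by
    rw [norm_neg]
    exact (ContinuousLinearMap.opNorm_comp_le _ _).trans (mul_le_of_le_one_right (norm_nonneg _)
      (ContinuousLinearMap.norm_fst_le ℝ E P))
  have hh := ((hsnd hH₀).add ((hsnd hH₁).mul hr')).add ((hsnd hH₂).mul (hr'.mul hr'))
  have hz := (hsnd hZ₀).add ((hsnd hZ₁).mul hr')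
  have hf := (hh.exp).mul ((hasDerivAt_stdGaussCdf _).comp_hasFDerivAt θ hz)
  have nh := norm_add_le_of_le (norm_add_le_of_le (nsnd bH₀)
    (norm_smul_add_smul_le (r := r) bH₁.1 nr' (nsnd bH₁.2)))
    (norm_smul_add_smul_le (r := r * r) bH₂.1
      (norm_smul_add_smul_le (c := r) (r := r) le_rfl nr' nr') (nsnd bH₂.2))
  have nz := norm_add_le_of_le (nsnd bZ₀.2)
    (norm_smul_add_smul_le (r := r) bZ₁.1 nr' (nsnd bZ₁.2))
  have hR : 0 ≤ |r| := abs_nonneg r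
  have bz : 1 + |Z₀ θ.2 + Z₁ θ.2 * r| ≤ (1 + M) * (1 + |r|) := by
    have h1 := abs_add_le (Z₀ θ.2) (Z₁ θ.2 * r)
    have h2 : |Z₁ θ.2 * r| ≤ M * |r| := by
      rw [abs_mul]; exact mul_le_mul_of_nonneg_right bZ₁.1 hR
    linarith [bZ₀.1]
  have mills := (stdGaussPdf_le_mul_stdGaussCdf (Z₀ θ.2 + Z₁ θ.2 * r)).trans
    (mul_le_mul_of_nonneg_right (mul_le_mul_of_nonneg_left bz (Real.exp_pos (3 / 2)).le)
      (stdGaussCdf_pos _).le)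
  have hMD : 0 ≤ M * D := mul_nonneg hM hD0
  have hMR : 0 ≤ M * |r| := mul_nonneg hM hR
  have hMDR : 0 ≤ M * D * |r| := mul_nonneg hMD hR
  have nh' := nh.trans (show _ ≤ 2 * M * (1 + |r|) ^ 2 * (1 + D) by
    rw [abs_mul]
    nlinarith [mul_nonneg hMR hR, mul_nonneg hMDR hR])
  have nz' := nz.trans (show _ ≤ M * (1 + |r|) * (1 + D) by nlinarith)
  refine (le_of_eq (congrArg norm hf.fderiv)).trans ?_
  refine (norm_add_le _ _).trans ?_
  simp only [norm_smul, Real.norm_eq_abs, Real.abs_exp, abs_of_pos (stdGaussPdf_pos _),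
    abs_of_pos (stdGaussCdf_pos _), Pi.add_apply, Pi.mul_apply, Function.comp_apply, ← hr]
  refine (add_le_add (mul_le_mul_of_nonneg_left
    (mul_le_mul mills nz' (norm_nonneg _)
      ((stdGaussPdf_pos _).le.trans mills)) (Real.exp_pos _).le)
    (mul_le_mul_of_nonneg_left (mul_le_mul_of_nonneg_left nh' (Real.exp_pos _).le)
      (stdGaussCdf_pos _).le)).trans (le_of_eq ?_)
  unfold skewDensity
  ring

/-- Uniform score bound for skew densities with exponentially decaying tails. -/
lemma exists_rpow_mul_norm_fderiv_skewDensity_le {K : Set P} (hK : IsCompact K)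
    (hH₀ : ∀ p ∈ K, ContDiffAt ℝ 1 H₀ p) (hH₁ : ∀ p ∈ K, ContDiffAt ℝ 1 H₁ p)
    (hH₂ : ∀ p ∈ K, ContDiffAt ℝ 1 H₂ p) (hZ₀ : ∀ p ∈ K, ContDiffAt ℝ 1 Z₀ p)
    (hZ₁ : ∀ p ∈ K, ContDiffAt ℝ 1 Z₁ p) {a B c : ℝ} (ha : 0 < a) (hc : 0 < c)
    (hdecay : ∀ p ∈ K, ∀ r, skewDensity H₀ H₁ H₂ Z₀ Z₁ p r ≤ Real.exp (B - c * |r|)) :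
    ∃ C : ℝ, ∀ (θ : E × P) (y : ℝ) (G : E → ℝ), θ.2 ∈ K → DifferentiableAt ℝ G θ.1 →
      skewDensity H₀ H₁ H₂ Z₀ Z₁ θ.2 (y - G θ.1) ^ (a - 1) *
        ‖fderiv ℝ (fun t : E × P => skewDensity H₀ H₁ H₂ Z₀ Z₁ t.2 (y - G t.1)) θ‖ ≤
      C * (1 + ‖fderiv ℝ G θ.1‖) := by
  obtain ⟨M₀, b₀⟩ := hK.exists_bound_of_contDiffAt hH₀
  obtain ⟨M₁, b₁⟩ := hK.exists_bound_of_contDiffAt hH₁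
  obtain ⟨M₂, b₂⟩ := hK.exists_bound_of_contDiffAt hH₂
  obtain ⟨N₀, d₀⟩ := hK.exists_bound_of_contDiffAt hZ₀
  obtain ⟨N₁, d₁⟩ := hK.exists_bound_of_contDiffAt hZ₁
  obtain ⟨M, hM0, h0, h1, h2, h3, h4⟩ :
      ∃ M, 0 ≤ M ∧ M₀ ≤ M ∧ M₁ ≤ M ∧ M₂ ≤ M ∧ N₀ ≤ M ∧ N₁ ≤ M := by
    refine ⟨|M₀| + |M₁| + |M₂| + |N₀| + |N₁|, by positivity, ?_, ?_, ?_, ?_, ?_⟩ <;>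
    linarith [le_abs_self M₀, le_abs_self M₁, le_abs_self M₂, le_abs_self N₀, le_abs_self N₁,
      abs_nonneg M₀, abs_nonneg M₁, abs_nonneg M₂, abs_nonneg N₀, abs_nonneg N₁]
  set k := min 1 (a * c / 2) with hk
  have hk0 : 0 < k := lt_min one_pos (by positivity)
  have hk1 : k ≤ 1 := min_le_left _ _
  have hk2 : 2 * k ≤ a * c := by linarith [min_le_right 1 (a * c / 2)]
  set L := 2 * M + Real.exp (3 / 2) * (1 + M) * M with hL
  have hL0 : 0 ≤ L := by positivity
  refine ⟨Real.exp (a * B) * L / k ^ 2, fun θ y G hθ hG => ?_⟩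
  set r := y - G θ.1 with hr
  have hf := skewDensity_pos (H₀ := H₀) (H₁ := H₁) (H₂ := H₂) (Z₀ := Z₀) (Z₁ := Z₁) θ.2 r
  set f := skewDensity H₀ H₁ H₂ Z₀ Z₁ θ.2 r with hfdef
  have hn := norm_fderiv_skewDensity_le (M := M) (y := y) hG
    ((hH₀ _ hθ).differentiableAt one_ne_zero) ((hH₁ _ hθ).differentiableAt one_ne_zero)
    ((hH₂ _ hθ).differentiableAt one_ne_zero) ((hZ₀ _ hθ).differentiableAt one_ne_zero)
    ((hZ₁ _ hθ).differentiableAt one_ne_zero) ((b₀ _ hθ).2.trans h0)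
    ((b₁ _ hθ).imp (·.trans h1) (·.trans h1)) ((b₂ _ hθ).imp (·.trans h2) (·.trans h2))
    ((d₀ _ hθ).imp (·.trans h3) (·.trans h3)) ((d₁ _ hθ).imp (·.trans h4) (·.trans h4))
  rw [← hr, ← hfdef] at hn
  have hpow : f ^ (a - 1) * f = f ^ a := by
    rw [← Real.rpow_add_one hf.ne', sub_add_cancel]
  have hfa : f ^ a ≤ Real.exp (a * B) * Real.exp (-(2 * (k * |r|))) := by
    calc f ^ a ≤ Real.exp (B - c * |r|) ^ a :=
          Real.rpow_le_rpow hf.le (hdecay _ hθ r) ha.le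
      _ = Real.exp (a * B + -(a * c * |r|)) := by rw [← Real.exp_mul]; ring_nf
      _ ≤ Real.exp (a * B + -(2 * (k * |r|))) := by
          refine Real.exp_le_exp.2 (add_le_add_right (neg_le_neg ?_) _)
          rw [← mul_assoc]
          exact mul_le_mul_of_nonneg_right hk2 (abs_nonneg r)
      _ = _ := Real.exp_add _ _
  have hexp : (1 + |r|) ^ 2 * Real.exp (-(2 * (k * |r|))) ≤ 1 / k ^ 2 := by
    have e1 : k * (1 + |r|) ≤ Real.exp (k * |r|) := by
      linarith [Real.add_one_le_exp (k * |r|)]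
    rw [le_div_iff₀ (by positivity)]
    calc (1 + |r|) ^ 2 * Real.exp (-(2 * (k * |r|))) * k ^ 2
        = (k * (1 + |r|)) ^ 2 * Real.exp (-(2 * (k * |r|))) := by ring
      _ ≤ Real.exp (k * |r|) ^ 2 * Real.exp (-(2 * (k * |r|))) := by gcongr
      _ = 1 := by rw [← Real.exp_nat_mul, ← Real.exp_add]; simp
  calc _ ≤ f ^ (a - 1) * (f * (L * (1 + |r|) ^ 2 * (1 + ‖fderiv ℝ G θ.1‖))) := by
        gcongr
    _ = f ^ a * (L * (1 + |r|) ^ 2 * (1 + ‖fderiv ℝ G θ.1‖)) := by rw [← mul_assoc, hpow]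
    _ ≤ Real.exp (a * B) * Real.exp (-(2 * (k * |r|))) *
          (L * (1 + |r|) ^ 2 * (1 + ‖fderiv ℝ G θ.1‖)) := by gcongr
    _ = Real.exp (a * B) * L * ((1 + |r|) ^ 2 * Real.exp (-(2 * (k * |r|)))) *
          (1 + ‖fderiv ℝ G θ.1‖) := by ring
    _ ≤ Real.exp (a * B) * L * (1 / k ^ 2) * (1 + ‖fderiv ℝ G θ.1‖) := by gcongr
    _ = _ := by ring

end SkewDensity

lemma ofReal_le_mul_one_add_iSup {ι : Type*} {s : Set ι} {D : ι → ℝ} (hD : ∀ i, 0 ≤ D i)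
    {C v : ℝ} {i : ι} (hi : i ∈ s) (h : v ≤ C * (1 + D i)) :
    ENNReal.ofReal v ≤ ENNReal.ofReal C * (1 + ⨆ j ∈ s, ENNReal.ofReal (D j)) := by
  refine (ENNReal.ofReal_le_ofReal h).trans ?_
  rw [ENNReal.ofReal_mul' (by linarith [hD i]), ENNReal.ofReal_add zero_le_one (hD i),
    ENNReal.ofReal_one]
  gcongr
  exact le_iSup₂_of_le i hi le_rfl

section NormalExponential

/-- The logarithm of the factor of the normal–exponential density that does not involve the
residual, as a function of `(σ_v, σ_u)`. -/
noncomputable def neLogCoeff (p : ℝ × ℝ) : ℝ := Real.log p.2⁻¹ + p.1 ^ 2 / (2 * p.2 ^ 2)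

lemma contDiffAt_neLogCoeff {p : ℝ × ℝ} (hp : 0 < p.2) : ContDiffAt ℝ 1 neLogCoeff p := by
  have h := hp.ne'
  unfold neLogCoeff
  fun_prop (disch := first | positivity | simpa using h)

lemma fNE_eq_skewDensity {p q : ℕ} (g : (Fin p → ℝ) → (Fin q → ℝ) → ℝ)
    {θ : (Fin q → ℝ) × ℝ × ℝ} (hθ : 0 < θ.2.2) (x : Fin p → ℝ) (y : ℝ) :
    fNE g θ x y = skewDensity neLogCoeff (fun p => p.2⁻¹) (fun _ => 0)
      (fun p => -(p.1 / p.2)) (fun p => -p.1⁻¹) θ.2 (y - g x θ.1) := by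
  simp only [fNE, skewDensity, neLogCoeff]
  simp only [Real.exp_add, Real.exp_log (inv_pos.2 hθ), zero_mul, Real.exp_zero, mul_one]
  rw [show -((y - g x θ.1) / θ.2.1) - θ.2.1 / θ.2.2 =
    -(θ.2.1 / θ.2.2) + -θ.2.1⁻¹ * (y - g x θ.1) by ring,
    show (y - g x θ.1) / θ.2.2 = θ.2.2⁻¹ * (y - g x θ.1) by ring]
  ring

lemma skewDensity_ne_le {v u s : ℝ} (hv : 0 < v) (hu : 0 < u) (hus : u ≤ s) (r : ℝ) :
    skewDensity neLogCoeff (fun p => p.2⁻¹) (fun _ => 0)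
      (fun p => -(p.1 / p.2)) (fun p => -p.1⁻¹) (v, u) r ≤
      Real.exp (neLogCoeff (v, u) + v ^ 2 / 2 - min 1 s⁻¹ * |r|) := by
  simp only [skewDensity, zero_mul, add_zero]
  rcases le_total 0 r with hr | hr
  · have hΦ := stdGaussCdf_le_exp (-(v / u) + -v⁻¹ * r) (v / u + v) (by positivity)
    refine (mul_le_mul_of_nonneg_left hΦ (Real.exp_pos _).le).trans ?_
    rw [← Real.exp_add, Real.exp_le_exp, abs_of_nonneg hr]
    have e : neLogCoeff (v, u) + u⁻¹ * r + ((v / u + v) * (-(v / u) + -v⁻¹ * r) +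
        (v / u + v) ^ 2 / 2) = neLogCoeff (v, u) - v ^ 2 / u ^ 2 / 2 + v ^ 2 / 2 - r := by
      field_simp
      ring
    rw [e]
    have h1 : min 1 s⁻¹ * r ≤ 1 * r := mul_le_mul_of_nonneg_right (min_le_left _ _) hr
    have h2 : 0 ≤ v ^ 2 / u ^ 2 / 2 := by positivity
    linarith
  · refine (mul_le_of_le_one_right (Real.exp_pos _).le (stdGaussCdf_le_one _)).trans ?_
    rw [Real.exp_le_exp, abs_of_nonpos hr]
    have h1 : min 1 s⁻¹ ≤ u⁻¹ := (min_le_right _ _).trans (inv_anti₀ hu hus)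
    have h2 := mul_le_mul_of_nonneg_right h1 (neg_nonneg.2 hr)
    have h3 : 0 ≤ v ^ 2 / 2 := by positivity
    linarith

end NormalExponential

section NormalTruncatedNormal

/-- The standard deviation `σ = √(σ_v² + σ_u²)` as a function of `(μ, σ_v, σ_u)`. -/
noncomputable def ntScale (p : ℝ × ℝ × ℝ) : ℝ := Real.sqrt (p.2.1 ^ 2 + p.2.2 ^ 2)

/-- The factor of the normal–truncated-normal density that does not involve the residual. -/
noncomputable def ntCoeff (p : ℝ × ℝ × ℝ) : ℝ :=
  (ntScale p)⁻¹ * (1 - stdGaussCdf (-(p.1 / p.2.2)))⁻¹ * (Real.sqrt (2 * Real.pi))⁻¹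

/-- The constant term of the log-quadratic part of the normal–truncated-normal density. -/
noncomputable def ntLogCoeff (p : ℝ × ℝ × ℝ) : ℝ :=
  Real.log (ntCoeff p) - p.1 ^ 2 / (2 * ntScale p ^ 2)

lemma ntScale_pos {p : ℝ × ℝ × ℝ} (hu : 0 < p.2.2) : 0 < ntScale p :=
  Real.sqrt_pos.2 (by positivity)

lemma ntCoeff_pos {p : ℝ × ℝ × ℝ} (hu : 0 < p.2.2) : 0 < ntCoeff p := by
  have h1 := ntScale_pos hu
  have h2 := sub_pos.2 (stdGaussCdf_lt_one (-(p.1 / p.2.2)))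
  unfold ntCoeff
  positivity

lemma contDiffAt_ntScale {p : ℝ × ℝ × ℝ} (hu : 0 < p.2.2) : ContDiffAt ℝ 1 ntScale p := by
  have h : p.2.1 ^ 2 + p.2.2 ^ 2 ≠ 0 := by positivity
  unfold ntScale
  exact ContDiffAt.sqrt (by fun_prop) h

lemma contDiffAt_ntCoeff {p : ℝ × ℝ × ℝ} (hu : 0 < p.2.2) : ContDiffAt ℝ 1 ntCoeff p := by
  have h2 := (sub_pos.2 (stdGaussCdf_lt_one (-(p.1 / p.2.2)))).ne'
  have h3 : ContDiffAt ℝ 1 (fun p : ℝ × ℝ × ℝ => -(p.1 / p.2.2)) p := by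
    fun_prop (disch := exact hu.ne')
  exact (((contDiffAt_ntScale hu).inv (ntScale_pos hu).ne').mul
    ((contDiffAt_const.sub (contDiff_stdGaussCdf.contDiffAt.comp p h3)).inv h2)).mul
    contDiffAt_const

lemma contDiffAt_ntLogCoeff {p : ℝ × ℝ × ℝ} (hu : 0 < p.2.2) : ContDiffAt ℝ 1 ntLogCoeff p := by
  have h := ntScale_pos hu
  exact ((contDiffAt_ntCoeff hu).log (ntCoeff_pos hu).ne').sub
    ((contDiffAt_fst.pow 2).div (contDiffAt_const.mul ((contDiffAt_ntScale hu).pow 2))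
      (by positivity))

lemma fNT_eq_skewDensity {p q : ℕ} (g : (Fin p → ℝ) → (Fin q → ℝ) → ℝ)
    {θ : (Fin q → ℝ) × ℝ × ℝ × ℝ} (hθ : 0 < θ.2.2.2) (x : Fin p → ℝ) (y : ℝ) :
    fNT g θ x y = skewDensity ntLogCoeff (fun p => -(p.1 / ntScale p ^ 2))
      (fun p => -(1 / (2 * ntScale p ^ 2))) (fun p => p.1 / (ntScale p * (p.2.2 / p.2.1)))
      (fun p => -(p.2.2 / p.2.1 / ntScale p)) θ.2 (y - g x θ.1) := by
  have hs := ntScale_pos hθ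
  simp only [fNT, skewDensity, stdGaussPdf]
  change (ntScale θ.2)⁻¹ * _ * (_ * Real.exp (-((_ / ntScale θ.2) ^ 2) / 2)) *
    stdGaussCdf (_ / (ntScale θ.2 * _) - _ / ntScale θ.2) = _
  rw [show θ.2.1 / (ntScale θ.2 * (θ.2.2.2 / θ.2.2.1)) -
      θ.2.2.2 / θ.2.2.1 * (y - g x θ.1) / ntScale θ.2 =
      θ.2.1 / (ntScale θ.2 * (θ.2.2.2 / θ.2.2.1)) +
      -(θ.2.2.2 / θ.2.2.1 / ntScale θ.2) * (y - g x θ.1) by ring,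
    show ntLogCoeff θ.2 + -(θ.2.1 / ntScale θ.2 ^ 2) * (y - g x θ.1) +
      -(1 / (2 * ntScale θ.2 ^ 2)) * ((y - g x θ.1) * (y - g x θ.1)) =
      Real.log (ntCoeff θ.2) + -(((y - g x θ.1 + θ.2.1) / ntScale θ.2) ^ 2) / 2 by
      unfold ntLogCoeff; field_simp; ring,
    Real.exp_add, Real.exp_log (ntCoeff_pos hθ), ntCoeff]
  ring

lemma skewDensity_nt_le {p : ℝ × ℝ × ℝ} (hu : 0 < p.2.2) (Z₀ Z₁ : ℝ × ℝ × ℝ → ℝ) (r : ℝ) :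
    skewDensity ntLogCoeff (fun p => -(p.1 / ntScale p ^ 2))
      (fun p => -(1 / (2 * ntScale p ^ 2))) Z₀ Z₁ p r ≤
      Real.exp (Real.log (ntCoeff p) + |p.1| + (p.2.1 ^ 2 + p.2.2 ^ 2) / 2 - |r|) := by
  have hs := ntScale_pos hu
  refine (mul_le_of_le_one_right (Real.exp_pos _).le (stdGaussCdf_le_one _)).trans ?_
  have hsq : p.2.1 ^ 2 + p.2.2 ^ 2 = ntScale p ^ 2 := (Real.sq_sqrt (by positivity)).symm
  rw [Real.exp_le_exp, hsq]
  have h1 : |r| ≤ |r + p.1| + |p.1| := by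
    simpa using abs_sub (r + p.1) p.1
  have h2 : |r + p.1| ≤ (r + p.1) ^ 2 / (2 * ntScale p ^ 2) + ntScale p ^ 2 / 2 := by
    have h3 : (r + p.1) ^ 2 / (2 * ntScale p ^ 2) + ntScale p ^ 2 / 2 - |r + p.1| =
        (|r + p.1| - ntScale p ^ 2) ^ 2 / (2 * ntScale p ^ 2) := by
      rw [← sq_abs (r + p.1)]
      field_simp
      ring
    have h4 : 0 ≤ (|r + p.1| - ntScale p ^ 2) ^ 2 / (2 * ntScale p ^ 2) := by positivity
    linarith
  have h5 : ntLogCoeff p + -(p.1 / ntScale p ^ 2) * r + -(1 / (2 * ntScale p ^ 2)) * (r * r) =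
      Real.log (ntCoeff p) - (r + p.1) ^ 2 / (2 * ntScale p ^ 2) := by
    unfold ntLogCoeff
    field_simp
    ring
  rw [h5]
  linarith

end NormalTruncatedNormal

/-- Lemma 3, first bound: for the normal–truncated-normal and
normal–exponential pseudo conditional densities, with Θ the compact box and g(x,β)
twice differentiable in β, for every α > 0 there is a finite constant C with
f_θ^{α−1}(y|x) ‖∂_θ f_θ(y|x)‖ ≤ C (1 + sup_{θ∈Θ} ‖∂_β g(x,β)‖) for all θ ∈ Θ, x, y
(the supremum being taken in [0,∞]). -/
theorem density_score_bound {p q : ℕ} (g : (Fin p → ℝ) → (Fin q → ℝ) → ℝ)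
    (hg1 : ∀ x, Differentiable ℝ (g x))
    (hg2 : ∀ x, Differentiable ℝ (fderiv ℝ (g x)))
    (a : ℝ) (ha : 0 < a)
    (bl bu ul uu sl su : ℝ) (hsl : 0 < sl) (hs : sl ≤ su) :
    (∃ C : ℝ≥0∞, C ≠ ⊤ ∧ ∀ θ ∈ boxNT q bl bu ul uu sl su, ∀ (x : Fin p → ℝ) (y : ℝ),
        ENNReal.ofReal (fNT g θ x y ^ (a - 1) * ‖fderiv ℝ (fun t => fNT g t x y) θ‖)
          ≤ C * (1 + ⨆ β ∈ Set.Icc (fun _ : Fin q => bl) (fun _ => bu),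
              ENNReal.ofReal ‖fderiv ℝ (g x) β‖))
    ∧ (∃ C : ℝ≥0∞, C ≠ ⊤ ∧ ∀ θ ∈ boxNE q bl bu sl su, ∀ (x : Fin p → ℝ) (y : ℝ),
        ENNReal.ofReal (fNE g θ x y ^ (a - 1) * ‖fderiv ℝ (fun t => fNE g t x y) θ‖)
          ≤ C * (1 + ⨆ β ∈ Set.Icc (fun _ : Fin q => bl) (fun _ => bu),
              ENNReal.ofReal ‖fderiv ℝ (g x) β‖)) := by
  refine ⟨?_, ?_⟩
  · have hK : IsCompact (Set.Icc ul uu ×ˢ (Set.Icc sl su ×ˢ Set.Icc sl su)) :=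
      isCompact_Icc.prod (isCompact_Icc.prod isCompact_Icc)
    have hv : ∀ p ∈ Set.Icc ul uu ×ˢ (Set.Icc sl su ×ˢ Set.Icc sl su), 0 < p.2.1 :=
      fun p hp => hsl.trans_le hp.2.1.1
    have hu : ∀ p ∈ Set.Icc ul uu ×ˢ (Set.Icc sl su ×ˢ Set.Icc sl su), 0 < p.2.2 :=
      fun p hp => hsl.trans_le hp.2.2.1
    obtain ⟨M, hM⟩ := hK.exists_bound_of_contDiffAt fun p hp =>
      (contDiffAt_ntCoeff (hu p hp)).log (ntCoeff_pos (hu p hp)).ne'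
    obtain ⟨C, hC⟩ := exists_rpow_mul_norm_fderiv_skewDensity_le (E := Fin q → ℝ) hK
      (H₀ := ntLogCoeff) (H₁ := fun p => -(p.1 / ntScale p ^ 2))
      (H₂ := fun p => -(1 / (2 * ntScale p ^ 2)))
      (Z₀ := fun p => p.1 / (ntScale p * (p.2.2 / p.2.1)))
      (Z₁ := fun p => -(p.2.2 / p.2.1 / ntScale p))
      (B := M + (|ul| + |uu|) + (su ^ 2 + su ^ 2) / 2) (c := 1)
      (fun p hp => contDiffAt_ntLogCoeff (hu p hp))
      (fun p hp => by
        have := contDiffAt_ntScale (hu p hp)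
        have := ntScale_pos (hu p hp)
        fun_prop (disch := positivity))
      (fun p hp => by
        have := contDiffAt_ntScale (hu p hp)
        have := ntScale_pos (hu p hp)
        fun_prop (disch := positivity))
      (fun p hp => by
        have := contDiffAt_ntScale (hu p hp)
        have := ntScale_pos (hu p hp)
        have := hu p hp
        have := hv p hp
        fun_prop (disch := positivity))
      (fun p hp => by
        have := contDiffAt_ntScale (hu p hp)
        have := ntScale_pos (hu p hp)
        have := hv p hp
        fun_prop (disch := positivity))
      ha one_pos
      (fun p hp r => by
        refine (skewDensity_nt_le (hu p hp) _ _ r).trans (Real.exp_le_exp.2 ?_)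
        have h1 := (le_abs_self _).trans (hM p hp).1
        have h2 : |p.1| ≤ |ul| + |uu| := abs_le.2
          ⟨by linarith [hp.1.1, neg_abs_le ul, abs_nonneg uu],
            by linarith [hp.1.2, le_abs_self uu, abs_nonneg ul]⟩
        have h3 := pow_le_pow_left₀ (hv p hp).le hp.2.1.2 2
        have h4 := pow_le_pow_left₀ (hu p hp).le hp.2.2.2 2
        linarith)
    refine ⟨ENNReal.ofReal C, ENNReal.ofReal_ne_top, fun θ hθ x y =>
      ofReal_le_mul_one_add_iSup (D := fun β => ‖fderiv ℝ (g x) β‖) (fun _ => norm_nonneg _)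
        hθ.1 ?_⟩
    have hpos := hu θ.2 hθ.2
    have heq : (fun t => fNT g t x y) =ᶠ[nhds θ] fun t => _ :=
      Filter.mem_of_superset ((isOpen_lt continuous_const (by fun_prop :
        Continuous fun t : (Fin q → ℝ) × ℝ × ℝ × ℝ => t.2.2.2)).mem_nhds hpos)
        fun t ht => fNT_eq_skewDensity g ht x y
    rw [fNT_eq_skewDensity g hpos, heq.fderiv_eq]
    exact hC θ y (g x) hθ.2 (hg1 x θ.1)
  · have hK : IsCompact (Set.Icc sl su ×ˢ Set.Icc sl su) := isCompact_Icc.prod isCompact_Icc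
    have hv : ∀ p ∈ Set.Icc sl su ×ˢ Set.Icc sl su, 0 < p.1 := fun p hp => hsl.trans_le hp.1.1
    have hu : ∀ p ∈ Set.Icc sl su ×ˢ Set.Icc sl su, 0 < p.2 := fun p hp => hsl.trans_le hp.2.1
    have hsu : 0 < su := hsl.trans_le hs
    obtain ⟨M, hM⟩ := hK.exists_bound_of_contDiffAt fun p hp => contDiffAt_neLogCoeff (hu p hp)
    obtain ⟨C, hC⟩ := exists_rpow_mul_norm_fderiv_skewDensity_le (E := Fin q → ℝ) hK
      (H₀ := neLogCoeff) (H₁ := fun p => p.2⁻¹) (H₂ := fun _ => 0)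
      (Z₀ := fun p => -(p.1 / p.2)) (Z₁ := fun p => -p.1⁻¹)
      (B := M + su ^ 2 / 2) (c := min 1 su⁻¹)
      (fun p hp => contDiffAt_neLogCoeff (hu p hp))
      (fun p hp => by fun_prop (disch := exact (hu p hp).ne'))
      (fun p hp => contDiffAt_const)
      (fun p hp => by fun_prop (disch := exact (hu p hp).ne'))
      (fun p hp => by fun_prop (disch := exact (hv p hp).ne'))
      ha (lt_min one_pos (inv_pos.2 hsu))
      (fun p hp r => by
        refine (skewDensity_ne_le (hv p hp) (hu p hp) hp.2.2 r).trans (Real.exp_le_exp.2 ?_)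
        have h1 := (le_abs_self _).trans (hM p hp).1
        have h2 := pow_le_pow_left₀ (hv p hp).le hp.1.2 2
        change neLogCoeff p + _ - _ ≤ _
        linarith)
    refine ⟨ENNReal.ofReal C, ENNReal.ofReal_ne_top, fun θ hθ x y =>
      ofReal_le_mul_one_add_iSup (D := fun β => ‖fderiv ℝ (g x) β‖) (fun _ => norm_nonneg _)
        hθ.1 ?_⟩
    have hpos := hu θ.2 hθ.2
    have heq : (fun t => fNE g t x y) =ᶠ[nhds θ] fun t => _ :=
      Filter.mem_of_superset ((isOpen_lt continuous_const (by fun_prop :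
        Continuous fun t : (Fin q → ℝ) × ℝ × ℝ => t.2.2)).mem_nhds hpos)
        fun t ht => fNE_eq_skewDensity g ht x y
    rw [fNE_eq_skewDensity g hpos, heq.fderiv_eq]
    exact hC θ y (g x) hθ.2 (hg1 x θ.1)
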